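/- arXiv:1011.3414 — 5 statements merged into one kernel-verified Lean document; each statement's English description precedes it below -/
import Mathlib

section
/- Let I ⊆ ℝ be an interval and U : I → ℝ^d a solution of system (1.1). Then for every t ∈ I the function t ↦ φ(U(t)) is differentiable with derivative equal to −( (h/2)·(U_1'(t))² + h·Σ_{i=2}^{d−1} (U_i'(t))² + (h/2)·(U_d'(t))² ); in particular, t ↦ φ(U(t)) is nonincreasing on I. -/
open scoped BigOperators
open Filter Topology Set

/-- The `n`-th coordinate (0-based) of a vector in `ℝ^d`, with junk value `0` out of range. -/
noncomputable def coordFn {d : ℕ} (u : Fin d → ℝ) (n : ℕ) : ℝ :=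
  if hn : n < d then u ⟨n, hn⟩ else 0

/-- The vector field `b` of system (1.1) (0-based indices: coordinate `1 ≤ k ≤ d` of the paper
is coordinate `k - 1` here). -/
noncomputable def bField (d : ℕ) (h p : ℝ) (u : Fin d → ℝ) (i : Fin d) : ℝ :=
  if (i : ℕ) = 0 then (2 / h ^ 2) * (-coordFn u 0 + coordFn u 1)
  else if (i : ℕ) = d - 1 then
    (2 / h ^ 2) * (-coordFn u (d - 1) + coordFn u (d - 2)
      + h * ((max (coordFn u (d - 1)) 0) ^ p - coordFn u (d - 1)))
  else (1 / h ^ 2) * (coordFn u ((i : ℕ) + 1) - 2 * coordFn u (i : ℕ) + coordFn u ((i : ℕ) - 1))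

/-- The potential `φ`. -/
noncomputable def phiFun (d : ℕ) (h p : ℝ) (u : Fin d → ℝ) : ℝ :=
  (1 / (2 * h)) * ∑ i ∈ Finset.range (d - 1), (coordFn u (i + 1) - coordFn u i) ^ 2
    - ((max (coordFn u (d - 1)) 0) ^ (p + 1) / (p + 1) - (coordFn u (d - 1)) ^ 2 / 2)

theorem hasDerivAt_max_zero_rpow_add_one_div {p : ℝ} (hp : 0 < p) (x : ℝ) :
    HasDerivAt (fun y : ℝ => (max y 0) ^ (p + 1) / (p + 1)) ((max x 0) ^ p) x := by
  have hcont (q : ℝ) (hq : 0 < q) : Continuous fun y : ℝ => (max y 0) ^ q :=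
    (continuous_id.max continuous_const).rpow_const fun _ => Or.inr hq.le
  have hp1 : p + 1 ≠ 0 := by positivity
  have hne (y : ℝ) (hy : y ≠ 0) :
      HasDerivAt (fun y : ℝ => (max y 0) ^ (p + 1) / (p + 1)) ((max y 0) ^ p) y := by
    rcases hy.lt_or_gt with hy | hy
    · rw [max_eq_right hy.le, Real.zero_rpow hp.ne']
      refine (hasDerivAt_const y (0 : ℝ)).congr_of_eventuallyEq ?_
      filter_upwards [Iio_mem_nhds hy] with z hz
      rw [max_eq_right (le_of_lt hz), Real.zero_rpow hp1, zero_div]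
    · rw [max_eq_left hy.le]
      have hd := (Real.hasDerivAt_rpow_const (x := y) (p := p + 1) (Or.inl hy.ne')).div_const (p + 1)
      rw [add_sub_cancel_right, mul_div_cancel_left₀ _ hp1] at hd
      refine hd.congr_of_eventuallyEq ?_
      filter_upwards [Ioi_mem_nhds hy] with z hz
      rw [max_eq_left (le_of_lt hz)]
  rcases eq_or_ne x 0 with rfl | hx
  · exact hasDerivAt_of_hasDerivAt_of_ne hne
      ((hcont (p + 1) (by positivity)).div_const _).continuousAt (hcont p hp).continuousAt
  · exact hne x hx

theorem sum_range_sub_mul_sub_eq (u v : ℕ → ℝ) (n : ℕ) :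
    ∑ i ∈ Finset.range (n + 1), (u (i + 1) - u i) * (v (i + 1) - v i)
      = (u (n + 1) - u n) * v (n + 1) - (u 1 - u 0) * v 0
        - ∑ i ∈ Finset.Ioo 0 (n + 1), (u (i + 1) - 2 * u i + u (i - 1)) * v i := by
  induction n with
  | zero =>
    have : Finset.Ioo 0 (0 + 1) = ∅ := by ext; simp; lia
    rw [this]
    simp
    ring
  | succ n ih =>
    have : Finset.Ioo 0 (n + 1 + 1) = insert (n + 1) (Finset.Ioo 0 (n + 1)) := by ext; grind
    rw [Finset.sum_range_succ, ih, this, Finset.sum_insert (by simp), Nat.add_sub_cancel]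
    ring

theorem HasDerivWithinAt.coordFn {d : ℕ} {U : ℝ → Fin d → ℝ} {v : Fin d → ℝ} {s : Set ℝ} {t : ℝ}
    (hU : HasDerivWithinAt U v s t) (n : ℕ) :
    HasDerivWithinAt (fun r => _root_.coordFn (U r) n) (_root_.coordFn v n) s t := by
  unfold _root_.coordFn
  split_ifs with hn
  · exact hasDerivWithinAt_pi.1 hU ⟨n, hn⟩
  · exact hasDerivWithinAt_const t s 0

theorem HasDerivWithinAt.phiFun {d : ℕ} {h p : ℝ} (hp : 0 < p) {U : ℝ → Fin d → ℝ}
    {v : Fin d → ℝ} {s : Set ℝ} {t : ℝ} (hU : HasDerivWithinAt U v s t) :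
    HasDerivWithinAt (fun r => _root_.phiFun d h p (U r))
      ((1 / h) * ∑ i ∈ Finset.range (d - 1),
          (_root_.coordFn (U t) (i + 1) - _root_.coordFn (U t) i)
            * (_root_.coordFn v (i + 1) - _root_.coordFn v i)
        - ((max (_root_.coordFn (U t) (d - 1)) 0) ^ p - _root_.coordFn (U t) (d - 1))
          * _root_.coordFn v (d - 1)) s t := by
  have hsum := (HasDerivWithinAt.fun_sum (u := Finset.range (d - 1)) fun i _ =>
    ((hU.coordFn (i + 1)).sub (hU.coordFn i)).fun_pow 2).const_mul (1 / (2 * h))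
  have hmax := (hasDerivAt_max_zero_rpow_add_one_div hp
    (_root_.coordFn (U t) (d - 1))).comp_hasDerivWithinAt t (hU.coordFn (d - 1))
  have hsq := ((hU.coordFn (d - 1)).fun_pow 2).div_const 2
  refine (hsum.sub (hmax.sub hsq)).congr_deriv ?_
  rw [Finset.mul_sum, Finset.mul_sum]
  congr 1
  · refine Finset.sum_congr rfl fun i _ => ?_
    simp
    ring
  · simp
    ring

theorem coordFn_bField_zero {d : ℕ} (hd : 0 < d) (h p : ℝ) (u : Fin d → ℝ) :
    coordFn (bField d h p u) 0 = (2 / h ^ 2) * (coordFn u 1 - coordFn u 0) := by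
  rw [coordFn, dif_pos hd, bField, if_pos rfl]
  ring

theorem coordFn_bField_last {d : ℕ} (hd : 2 ≤ d) (h p : ℝ) (u : Fin d → ℝ) :
    coordFn (bField d h p u) (d - 1) =
      (2 / h ^ 2) * (-coordFn u (d - 1) + coordFn u (d - 2)
        + h * ((max (coordFn u (d - 1)) 0) ^ p - coordFn u (d - 1))) := by
  rw [coordFn, dif_pos (by lia), bField, if_neg (by simp; lia), if_pos rfl]

theorem coordFn_bField_of_mem_Ioo {d i : ℕ} (hi : i ∈ Finset.Ioo 0 (d - 1)) (h p : ℝ)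
    (u : Fin d → ℝ) :
    coordFn (bField d h p u) i =
      (1 / h ^ 2) * (coordFn u (i + 1) - 2 * coordFn u i + coordFn u (i - 1)) := by
  rw [Finset.mem_Ioo] at hi
  rw [coordFn, dif_pos (by lia), bField, if_neg (by simp; lia), if_neg (by simp; lia)]

theorem hasDerivWithinAt_phiFun_of_bField {d : ℕ} (hd : 2 ≤ d) {h p : ℝ} (hh : h ≠ 0)
    (hp : 0 < p) {U : ℝ → Fin d → ℝ} {s : Set ℝ} {t : ℝ}
    (hU : HasDerivWithinAt U (bField d h p (U t)) s t) :
    HasDerivWithinAt (fun r => phiFun d h p (U r))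
      (-((h / 2) * (coordFn (bField d h p (U t)) 0) ^ 2
        + h * ∑ i ∈ Finset.Ioo 0 (d - 1), (coordFn (bField d h p (U t)) i) ^ 2
        + (h / 2) * (coordFn (bField d h p (U t)) (d - 1)) ^ 2)) s t := by
  refine (hU.phiFun hp).congr_deriv ?_
  have hzero := coordFn_bField_zero (by lia) h p (U t)
  have hlast := coordFn_bField_last hd h p (U t)
  have hmid : ∑ i ∈ Finset.Ioo 0 (d - 1),
      (coordFn (U t) (i + 1) - 2 * coordFn (U t) i + coordFn (U t) (i - 1))
        * coordFn (bField d h p (U t)) i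
      = h ^ 2 * ∑ i ∈ Finset.Ioo 0 (d - 1), (coordFn (bField d h p (U t)) i) ^ 2 := by
    rw [Finset.mul_sum]
    refine Finset.sum_congr rfl fun i hi => ?_
    rw [coordFn_bField_of_mem_Ioo hi]
    field_simp
  have hparts := sum_range_sub_mul_sub_eq (coordFn (U t)) (coordFn (bField d h p (U t))) (d - 2)
  rw [show d - 2 + 1 = d - 1 by lia, hmid] at hparts
  rw [hparts]
  generalize ∑ i ∈ Finset.Ioo 0 (d - 1), (coordFn (bField d h p (U t)) i) ^ 2 = S
  rw [hzero, hlast]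
  field_simp
  ring

/-- along any solution `U` of (1.1) on an interval `I`, the map `t ↦ φ(U(t))` is
differentiable with derivative `-((h/2)(U₁')² + h ∑_{i=2}^{d-1} (Uᵢ')² + (h/2)(U_d')²)`
(where `U'(t) = b(U(t))`); in particular it is nonincreasing on `I`. -/
theorem stmt0 (d : ℕ) (hd : 2 ≤ d) (h p : ℝ) (hh : 0 < h) (hp : 1 < p)
    (I : Set ℝ) (hI : I.OrdConnected) (U : ℝ → Fin d → ℝ)
    (hU : ∀ t ∈ I, HasDerivWithinAt U (bField d h p (U t)) I t) :
    (∀ t ∈ I, HasDerivWithinAt (fun s => phiFun d h p (U s))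
        (-((h / 2) * (coordFn (bField d h p (U t)) 0) ^ 2
          + h * ∑ i ∈ Finset.Ioo 0 (d - 1), (coordFn (bField d h p (U t)) i) ^ 2
          + (h / 2) * (coordFn (bField d h p (U t)) (d - 1)) ^ 2)) I t) ∧
    AntitoneOn (fun t => phiFun d h p (U t)) I := by
  have hderiv (t : ℝ) (ht : t ∈ I) :=
    hasDerivWithinAt_phiFun_of_bField hd hh.ne' (zero_lt_one.trans hp) (hU t ht)
  refine ⟨hderiv, antitoneOn_of_hasDerivWithinAt_nonpos hI.convex
    (fun t ht => (hderiv t ht).continuousWithinAt)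
    (fun t ht => (hderiv t (interior_subset ht)).mono interior_subset) fun t _ => ?_⟩
  rw [neg_nonpos]
  positivity
end

section
/- (Maximum Principle) Let T > 0 and let U : [0,T] → ℝ^d be a solution of system (1.1). Then for every t ∈ [0,T] and every k ∈ {1,…,d}, |U_k(t)| ≤ max{ max_{j=1,…,d} |U_j(0)| , max_{0 ≤ s ≤ t} U_d(s) }. -/
open scoped BigOperators
open Filter Topology Set

/-- At a maximum over `[0,t]` attained away from `0`, the one-sided derivative is nonnegative. -/
lemma deriv_nonneg_of_isMaxOn_Icc {f : ℝ → ℝ} {f' t s : ℝ} (hs : s ∈ Icc 0 t) (h0 : 0 < s)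
    (hf : HasDerivWithinAt f f' (Icc 0 t) s) (hmax : IsMaxOn f (Icc 0 t) s) : 0 ≤ f' := by
  have hseg : segment ℝ s 0 ⊆ Icc 0 t :=
    (convex_Icc 0 t).segment_subset hs ⟨le_rfl, hs.1.trans hs.2⟩
  have h := hmax.localize.hasFDerivWithinAt_nonpos hf.hasFDerivWithinAt
    (sub_mem_posTangentConeAt_of_segment_subset hseg)
  simp at h
  exact nonneg_of_mul_nonneg_right h h0

/-- A family of functions whose largest member, whenever it exceeds `M`, has nonpositive
derivative stays below `M` if it starts below `M`. -/
lemma le_of_deriv_nonpos_at_max {ι : Type*} [Finite ι] {V F : ℝ → ι → ℝ} {t M : ℝ}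
    (hV : ∀ s ∈ Icc 0 t, ∀ k, HasDerivWithinAt (fun r => V r k) (F s k) (Icc 0 t) s)
    (hV0 : ∀ k, V 0 k ≤ M)
    (hF : ∀ s ∈ Icc 0 t, ∀ k, (∀ j, V s j ≤ V s k) → V s k ≤ M ∨ F s k ≤ 0)
    {s : ℝ} (hs : s ∈ Icc 0 t) (k : ι) : V s k ≤ M := by
  have ht : 0 ≤ t := hs.1.trans hs.2
  suffices H : ∀ ε > 0, V s k - ε * s ≤ M by
    refine le_of_forall_pos_le_add fun δ hδ => ?_
    have hε : 0 < δ / (t + 1) := by positivity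
    have h1 := H _ hε
    have h2 : δ / (t + 1) * s ≤ δ := by
      rw [div_mul_eq_mul_div, div_le_iff₀ (by positivity)]
      nlinarith [hs.2]
    linarith
  intro ε hε
  have hd : ∀ r ∈ Icc 0 t, ∀ j,
      HasDerivWithinAt (fun r => V r j - ε * r) (F r j - ε) (Icc 0 t) r := fun r hr j => by
    have := (hV r hr j).sub ((hasDerivWithinAt_id r (Icc 0 t)).const_mul ε)
    rw [mul_one] at this
    exact this
  have hmax : ∀ j, ∃ r ∈ Icc 0 t, IsMaxOn (fun r => V r j - ε * r) (Icc 0 t) r := fun j =>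
    isCompact_Icc.exists_isMaxOn ⟨s, hs⟩ fun r hr => (hd r hr j).continuousWithinAt
  choose r hr hrmax using hmax
  have : Nonempty ι := ⟨k⟩
  obtain ⟨j, hj⟩ := Finite.exists_max fun j => V (r j) j - ε * r j
  have hbd : ∀ x ∈ Icc 0 t, ∀ i, V x i - ε * x ≤ V (r j) j - ε * r j := fun x hx i =>
    (hrmax i hx).trans (hj i)
  refine (hbd s hs k).trans ?_
  rcases (hr j).1.eq_or_lt with h0 | h0
  · rw [← h0]
    simpa using hV0 j
  · have h1 := deriv_nonneg_of_isMaxOn_Icc (hr j) h0 (hd _ (hr j) j) (hrmax j)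
    rcases hF (r j) (hr j) j fun i => by linarith [hbd (r j) (hr j) i] with h2 | h2
    · nlinarith
    · linarith

lemma coordFn_of_lt {d : ℕ} (u : Fin d → ℝ) {n : ℕ} (hn : n < d) :
    coordFn u n = u ⟨n, hn⟩ := dif_pos hn

/-- Away from the last coordinate, the vector field is nonpositive at a maximal coordinate. -/
lemma bField_nonpos_of_max {d : ℕ} (hd : 2 ≤ d) (h p : ℝ) {u : Fin d → ℝ} {k : Fin d}
    (hk : (k : ℕ) ≠ d - 1) (hmax : ∀ j, u j ≤ u k) : bField d h p u k ≤ 0 := by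
  have hkd := k.2
  have hc : ∀ n < d, coordFn u n ≤ u k := fun n hn => coordFn_of_lt u hn ▸ hmax _
  have hck : coordFn u k = u k := coordFn_of_lt u k.2
  unfold bField
  split_ifs with h0
  · rw [h0] at hck
    exact mul_nonpos_of_nonneg_of_nonpos (by positivity) (by linarith [hc 1 (by omega)])
  · exact mul_nonpos_of_nonneg_of_nonpos (by positivity)
      (by linarith [hc (k + 1) (by omega), hc (k - 1) (by omega)])

/-- The vector field is nonnegative at a minimal coordinate, if that coordinate is nonpositive. -/
lemma bField_nonneg_of_min {d : ℕ} (hd : 2 ≤ d) {h p : ℝ} (hh : 0 ≤ h) {u : Fin d → ℝ}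
    {k : Fin d} (hmin : ∀ j, u k ≤ u j) (hk : u k ≤ 0) : 0 ≤ bField d h p u k := by
  have hkd := k.2
  have hc : ∀ n < d, u k ≤ coordFn u n := fun n hn => (coordFn_of_lt u hn).symm ▸ hmin _
  have hck : coordFn u k = u k := coordFn_of_lt u k.2
  unfold bField
  split_ifs with h0 h1
  · rw [h0] at hck
    exact mul_nonneg (by positivity) (by linarith [hc 1 (by omega)])
  · rw [h1] at hck
    refine mul_nonneg (by positivity) ?_
    have hg : 0 ≤ (max (coordFn u (d - 1)) 0) ^ p := Real.rpow_nonneg (le_max_right _ _) p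
    have := mul_nonneg hh (show 0 ≤ (max (coordFn u (d - 1)) 0) ^ p - coordFn u (d - 1) by linarith)
    linarith [hc (d - 2) (by omega)]
  · exact mul_nonneg (by positivity)
      (by linarith [hc (k + 1) (by omega), hc (k - 1) (by omega)])

/-- Maximum Principle: for a solution `U` of (1.1) on `[0,T]`, every coordinate
satisfies `|U_k(t)| ≤ max{max_j |U_j(0)|, max_{0 ≤ s ≤ t} U_d(s)}`. -/
theorem stmt1 (d : ℕ) (hd : 2 ≤ d) (h p T : ℝ) (hh : 0 < h) (hp : 1 < p) (hT : 0 < T)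
    (U : ℝ → Fin d → ℝ)
    (hU : ∀ t ∈ Set.Icc 0 T, HasDerivWithinAt U (bField d h p (U t)) (Set.Icc 0 T) t)
    (t : ℝ) (ht : t ∈ Set.Icc 0 T) (k : Fin d) :
    |U t k| ≤ max (⨆ j : Fin d, |U 0 j|)
      (sSup ((fun s => coordFn (U s) (d - 1)) '' Set.Icc 0 t)) := by
  have hd1 : d - 1 < d := by omega
  have hsub : Icc 0 t ⊆ Icc 0 T := Icc_subset_Icc_right ht.2
  have hD : ∀ s ∈ Icc 0 t, ∀ j,
      HasDerivWithinAt (fun r => U r j) (bField d h p (U s) j) (Icc 0 t) s := fun s hs j =>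
    (hasDerivWithinAt_pi.1 (hU s (hsub hs)) j).mono hsub
  have hinit : ∀ j, |U 0 j| ≤ ⨆ j : Fin d, |U 0 j| := fun j =>
    le_ciSup (f := fun j => |U 0 j|) (Set.finite_range _).bddAbove j
  have hlast : ∀ s ∈ Icc 0 t, coordFn (U s) (d - 1) ≤
      sSup ((fun s => coordFn (U s) (d - 1)) '' Icc 0 t) := by
    have hcont : ContinuousOn (fun s => coordFn (U s) (d - 1)) (Icc 0 t) := by
      simp only [coordFn_of_lt _ hd1]
      exact fun s hs => (hD s hs _).continuousWithinAt
    exact fun s hs => le_csSup (isCompact_Icc.image_of_continuousOn hcont).bddAbove ⟨s, hs, rfl⟩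
  set M := max (⨆ j : Fin d, |U 0 j|) (sSup ((fun s => coordFn (U s) (d - 1)) '' Icc 0 t))
  have hM0 : ∀ j, |U 0 j| ≤ M := fun j => (hinit j).trans (le_max_left _ _)
  have hM : 0 ≤ M := (abs_nonneg _).trans (hM0 k)
  have hts : t ∈ Icc 0 t := ⟨ht.1, le_rfl⟩
  refine abs_le'.2 ⟨?_, ?_⟩
  · refine le_of_deriv_nonpos_at_max hD (fun j => (le_abs_self _).trans (hM0 j))
      (fun s hs j hj => ?_) hts k
    by_cases hjd : (j : ℕ) = d - 1
    · left
      have h1 : coordFn (U s) j = U s j := coordFn_of_lt _ j.2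
      rw [← h1, hjd]
      exact (hlast s hs).trans (le_max_right _ _)
    · exact Or.inr (bField_nonpos_of_max hd h p hjd hj)
  · refine le_of_deriv_nonpos_at_max (V := fun s j => -U s j)
      (F := fun s j => -bField d h p (U s) j) (fun s hs j => (hD s hs j).neg)
      (fun j => (neg_le_abs _).trans (hM0 j)) (fun s hs j hj => ?_) hts k
    rcases le_total 0 (U s j) with h0 | h0
    · left
      linarith
    · exact Or.inr (neg_nonpos.2
        (bField_nonneg_of_min hd hh.le (fun i => neg_le_neg_iff.1 (hj i)) h0))
end

section
/- Every globally defined solution of system (1.1) is bounded: if U : [0,∞) → ℝ^d is a solution of (1.1), then sup_{t ≥ 0} |U(t)| < ∞. -/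
open scoped BigOperators
open Filter Topology Set

/-- The Euclidean norm on `ℝ^d`. -/
noncomputable def euclNorm {d : ℕ} (u : Fin d → ℝ) : ℝ := Real.sqrt (∑ i, (u i) ^ 2)

/-- If `J ≤ M' / 2` along with `J' ≥ κ M'` and `J' M ≥ q M' ^ 2 / 2` for some `q > 1`, then a
positive value of `J` would force `M` to blow up in finite time. -/
lemma nonpos_of_concavity_ineq {M J M' J' : ℝ → ℝ} {κ q : ℝ} (hκ : 0 < κ) (hq : 1 < q)
    (hM : ∀ t, 0 ≤ t → HasDerivWithinAt M (M' t) (Ici 0) t)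
    (hJ : ∀ t, 0 ≤ t → HasDerivWithinAt J (J' t) (Ici 0) t)
    (hM0 : ∀ t, 0 ≤ t → 0 ≤ M t)
    (hJM : ∀ t, 0 ≤ t → 2 * J t ≤ M' t)
    (hJ1 : ∀ t, 0 ≤ t → κ * M' t ≤ J' t)
    (hJ2 : ∀ t, 0 ≤ t → 0 ≤ M' t → q / 2 * M' t ^ 2 ≤ J' t * M t) :
    ∀ t, 0 ≤ t → J t ≤ 0 := by
  intro t₀ ht₀
  by_contra! hpos
  have mono : ∀ (F F' : ℝ → ℝ) (a : ℝ), 0 ≤ a →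
      (∀ t, a ≤ t → HasDerivWithinAt F (F' t) (Ici 0) t) → (∀ t, a ≤ t → 0 ≤ F' t) →
      ∀ t, a ≤ t → F a ≤ F t := by
    intro F F' a ha hF hF' t hat
    have : MonotoneOn F (Ici a) := by
      refine monotoneOn_of_hasDerivWithinAt_nonneg (f' := F') (convex_Ici a) ?_ ?_ ?_
      · exact fun x hx => ((hF x hx).mono (Ici_subset_Ici.2 ha)).continuousWithinAt
      · intro x hx
        rw [interior_Ici] at hx ⊢
        exact (hF x hx.le).mono fun y hy => ha.trans (le_of_lt hy)
      · intro x hx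
        rw [interior_Ici] at hx
        exact hF' x hx.le
    exact this self_mem_Ici hat hat
  have hJpos : ∀ t, t₀ ≤ t → 0 < J t := by
    intro t ht
    have key := mono (fun s => J s * Real.exp (-(2 * κ) * s))
      (fun s => J' s * Real.exp (-(2 * κ) * s)
        + J s * (Real.exp (-(2 * κ) * s) * (-(2 * κ) * 1))) t₀ ht₀
      (fun s hs => (hJ s (ht₀.trans hs)).mul
        (((hasDerivWithinAt_id s _).const_mul (-(2 * κ))).exp)) (fun s hs => by
          have h1 := hJM s (ht₀.trans hs)
          have h2 := hJ1 s (ht₀.trans hs)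
          have h3 : 0 ≤ J' s - 2 * κ * J s := by nlinarith
          have h4 := mul_nonneg h3 (Real.exp_pos (-(2 * κ) * s)).le
          linarith) t ht
    have h1 : 0 < J t * Real.exp (-(2 * κ) * t) :=
      lt_of_lt_of_le (mul_pos hpos (Real.exp_pos _)) key
    exact (pos_iff_pos_of_mul_pos h1).2 (Real.exp_pos _)
  have hM'pos : ∀ t, t₀ ≤ t → 0 < M' t := fun t ht => by
    have := hJM t (ht₀.trans ht)
    have := hJpos t ht
    linarith
  have hMpos : ∀ t, t₀ + 1 ≤ t → 0 < M t := by
    intro t ht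
    have key : StrictMonoOn M (Ici t₀) := by
      refine strictMonoOn_of_hasDerivWithinAt_pos (f' := M') (convex_Ici t₀) ?_ ?_ ?_
      · exact fun x hx =>
          ((hM x (ht₀.trans hx)).mono (Ici_subset_Ici.2 ht₀)).continuousWithinAt
      · intro x hx
        rw [interior_Ici] at hx ⊢
        exact (hM x (ht₀.trans hx.le)).mono fun y hy => ht₀.trans (le_of_lt hy)
      · intro x hx
        rw [interior_Ici] at hx
        exact hM'pos x hx.le
    have h1 := key self_mem_Ici (show t ∈ Ici t₀ by simp only [mem_Ici]; linarith)
      (show t₀ < t by linarith)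
    exact (hM0 t₀ ht₀).trans_lt h1
  set t₁ := t₀ + 1 with ht₁
  have ht₁0 : 0 ≤ t₁ := by linarith
  have hL : ∀ t, t₁ ≤ t → J t₁ * M t₁ ^ (-q) ≤ J t * M t ^ (-q) := by
    refine mono (fun s => J s * M s ^ (-q))
      (fun s => J' s * M s ^ (-q) + J s * (M' s * (-q) * M s ^ (-q - 1))) t₁ ht₁0
      (fun s hs => (hJ s (ht₁0.trans hs)).mul
        ((hM s (ht₁0.trans hs)).rpow_const (Or.inl (hMpos s hs).ne'))) (fun s hs => ?_)
    have hMs := hMpos s hs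
    have hpow : M s ^ (-q) = M s ^ (-q - 1) * M s := by
      rw [Real.rpow_sub_one hMs.ne']; field_simp
    have h1 := hJM s (ht₁0.trans hs)
    have h3 := hM'pos s (by linarith)
    have h2 := hJ2 s (ht₁0.trans hs) h3.le
    have h4 : 0 ≤ J' s * M s - q * M' s * J s := by
      nlinarith [mul_nonneg (mul_nonneg (by linarith : (0:ℝ) ≤ q) h3.le) (sub_nonneg.2 h1)]
    have h5 := mul_nonneg h4 (Real.rpow_pos_of_pos hMs (-q - 1)).le
    rw [hpow]
    linarith
  set L := J t₁ * M t₁ ^ (-q) with hLdef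
  have hLpos : 0 < L := mul_pos (hJpos t₁ (by linarith)) (Real.rpow_pos_of_pos (hMpos t₁ le_rfl) _)
  set c := 2 * (q - 1) * L with hc
  have hcpos : 0 < c := by
    have : 0 < q - 1 := by linarith
    positivity
  have hΦ : ∀ t, t₁ ≤ t → -(c * t₁) - M t₁ ^ (1 - q) ≤ -(c * t) - M t ^ (1 - q) := by
    refine mono (fun s => -(c * s) - M s ^ (1 - q))
      (fun s => -(c * 1) - M' s * (1 - q) * M s ^ (1 - q - 1)) t₁ ht₁0
      (fun s hs => (((hasDerivWithinAt_id s _).const_mul c).neg).sub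
        ((hM s (ht₁0.trans hs)).rpow_const (Or.inl (hMpos s hs).ne'))) (fun s hs => ?_)
    have h1 := hJM s (ht₁0.trans hs)
    have h2 := hL s hs
    have h3 := Real.rpow_pos_of_pos (hMpos s hs) (-q)
    have e : 1 - q - 1 = -q := by ring
    rw [e, hc]
    have h4 : 2 * L ≤ M' s * M s ^ (-q) := by nlinarith
    nlinarith
  have hA : 0 < M t₁ ^ (1 - q) := Real.rpow_pos_of_pos (hMpos t₁ le_rfl) _
  have hle : t₁ ≤ t₁ + M t₁ ^ (1 - q) / c := by
    have := div_pos hA hcpos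
    linarith
  have h1 := hΦ _ hle
  have h2 := Real.rpow_pos_of_pos (hMpos _ hle) (1 - q)
  have h3 : c * (t₁ + M t₁ ^ (1 - q) / c) = c * t₁ + M t₁ ^ (1 - q) := by field_simp
  linarith

/-- The function `s ↦ max s 0 ^ (p + 1) / (p + 1)` is a primitive of `s ↦ max s 0 ^ p`. -/
lemma hasDerivAt_max_zero_rpow {p : ℝ} (hp : 0 < p) (s : ℝ) :
    HasDerivAt (fun x : ℝ => max x 0 ^ (p + 1) / (p + 1)) (max s 0 ^ p) s := by
  have hp1 : p + 1 ≠ 0 := by linarith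
  have hpow : ∀ x : ℝ, HasDerivAt (fun x : ℝ => x ^ (p + 1) / (p + 1)) (x ^ p) x := by
    intro x
    have := (Real.hasDerivAt_rpow_const (x := x) (p := p + 1) (Or.inr (by linarith))).div_const
      (p + 1)
    refine this.congr_deriv ?_
    rw [add_sub_cancel_right]
    field_simp
  rcases lt_trichotomy s 0 with hs | rfl | hs
  · have h0 : max s 0 ^ p = 0 := by rw [max_eq_right hs.le, Real.zero_rpow hp.ne']
    rw [h0]
    refine (hasDerivAt_const s (0 : ℝ)).congr_of_eventuallyEq ?_
    filter_upwards [eventually_lt_nhds hs] with x hx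
    rw [max_eq_right hx.le, Real.zero_rpow hp1, zero_div]
  · rw [← hasDerivWithinAt_univ, ← Iic_union_Ici (a := (0 : ℝ))]
    refine HasDerivWithinAt.union ?_ ?_
    · rw [max_self, Real.zero_rpow hp.ne']
      refine (hasDerivWithinAt_const (0 : ℝ) _ (0 : ℝ)).congr (fun x hx => ?_) ?_
      · rw [max_eq_right hx, Real.zero_rpow hp1, zero_div]
      · rw [max_self, Real.zero_rpow hp1, zero_div]
    · rw [max_self]
      refine (hpow 0).hasDerivWithinAt.congr (fun x hx => ?_) ?_
      · rw [max_eq_left hx]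
      · rw [max_self]
  · rw [max_eq_left hs.le]
    refine (hpow s).congr_of_eventuallyEq ?_
    filter_upwards [eventually_gt_nhds hs] with x hx
    rw [max_eq_left hx.le]

/-- Summation by parts for the discrete Laplacian with Neumann condition on the left and flux `G`
on the right. -/
lemma sum_by_parts_flux {h G : ℝ} (hh : h ≠ 0) (k : ℕ) (f v x : ℕ → ℝ)
    (h0 : v 0 = 2 / h ^ 2 * (-f 0 + f 1))
    (hi : ∀ n, n < k → v (n + 1) = 1 / h ^ 2 * (f (n + 2) - 2 * f (n + 1) + f n))
    (hl : v (k + 1) = 2 / h ^ 2 * (-f (k + 1) + f k + h * G)) :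
    h / 2 * ∑ n ∈ Finset.range (k + 1), (x n * v n + x (n + 1) * v (n + 1))
      = -(1 / h) * ∑ n ∈ Finset.range (k + 1), (x (n + 1) - x n) * (f (n + 1) - f n)
        + x (k + 1) * G := by
  have partial_sum : ∀ j, j ≤ k →
      h / 2 * ∑ n ∈ Finset.range j, (x n * v n + x (n + 1) * v (n + 1))
      = -(1 / h) * ∑ n ∈ Finset.range j, (x (n + 1) - x n) * (f (n + 1) - f n)
        + x j * (1 / h * (f (j + 1) - f j) - h / 2 * v j) := by
    intro j
    induction j with
    | zero =>
      intro _
      simp only [Finset.range_zero, Finset.sum_empty, h0, zero_add]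
      field_simp
      ring
    | succ j ih =>
      intro hj
      rw [Finset.sum_range_succ, Finset.sum_range_succ, mul_add, mul_add, ih (by omega),
        hi j (by omega)]
      field_simp
      ring
  rw [Finset.sum_range_succ, Finset.sum_range_succ, mul_add, mul_add, partial_sum k le_rfl, hl]
  field_simp
  ring

/-- A discrete Poincaré inequality. -/
lemma exists_discrete_poincare (m : ℕ) :
    ∃ C : ℝ, 0 < C ∧ ∀ f : ℕ → ℝ, ∑ n ∈ Finset.range m, (f n ^ 2 + f (n + 1) ^ 2)
      ≤ C * (∑ n ∈ Finset.range m, (f (n + 1) - f n) ^ 2 + f m ^ 2) := by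
  induction m with
  | zero => exact ⟨1, one_pos, fun f => by simpa using sq_nonneg (f 0)⟩
  | succ m ih =>
    obtain ⟨C, hC, hf⟩ := ih
    refine ⟨2 * C + 3, by linarith, fun f => ?_⟩
    rw [Finset.sum_range_succ, Finset.sum_range_succ]
    have h1 := hf f
    have h2 : f m ^ 2 ≤ 2 * ((f (m + 1) - f m) ^ 2 + f (m + 1) ^ 2) := by
      nlinarith [sq_nonneg (2 * f (m + 1) - f m)]
    have h3 : 0 ≤ ∑ n ∈ Finset.range m, (f (n + 1) - f n) ^ 2 :=
      Finset.sum_nonneg fun _ _ => sq_nonneg _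
    nlinarith [sq_nonneg (f (m + 1) - f m), sq_nonneg (f (m + 1)),
      mul_le_mul_of_nonneg_left h2 hC.le]

/-- Global solutions of the semidiscrete system, written with coordinates indexed by `ℕ`, stay
bounded. -/
lemma exists_bound_of_semidiscrete {h p : ℝ} (hh : 0 < h) (hp : 1 < p) (k : ℕ) (f v : ℕ → ℝ → ℝ)
    (hf : ∀ n, n ≤ k + 1 → ∀ t, 0 ≤ t → HasDerivWithinAt (f n) (v n t) (Ici 0) t)
    (h0 : ∀ t, v 0 t = 2 / h ^ 2 * (-f 0 t + f 1 t))
    (hi : ∀ t n, n < k → v (n + 1) t = 1 / h ^ 2 * (f (n + 2) t - 2 * f (n + 1) t + f n t))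
    (hl : ∀ t, v (k + 1) t = 2 / h ^ 2 * (-f (k + 1) t + f k t
      + h * (max (f (k + 1) t) 0 ^ p - f (k + 1) t))) :
    ∃ B : ℝ, ∀ t, 0 ≤ t →
      ∑ n ∈ Finset.range (k + 1), (f n t ^ 2 + f (n + 1) t ^ 2) ≤ B := by
  obtain ⟨C, hC, hpoin⟩ := exists_discrete_poincare (k + 1)
  set D : ℝ → ℝ := fun t => ∑ n ∈ Finset.range (k + 1), (f (n + 1) t - f n t) ^ 2 with hD
  set M : ℝ → ℝ := fun t => ∑ n ∈ Finset.range (k + 1), (f n t ^ 2 + f (n + 1) t ^ 2) with hMdef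
  set N : ℝ → ℝ := fun t => ∑ n ∈ Finset.range (k + 1), (v n t ^ 2 + v (n + 1) t ^ 2) with hN
  set S : ℝ → ℝ := fun t =>
    ∑ n ∈ Finset.range (k + 1), (f n t * v n t + f (n + 1) t * v (n + 1) t) with hS
  set E : ℝ → ℝ := fun t => 1 / (2 * h) * D t
    - (max (f (k + 1) t) 0 ^ (p + 1) / (p + 1) - f (k + 1) t ^ 2 / 2) with hE
  have hNnn : ∀ t, 0 ≤ N t := fun t => Finset.sum_nonneg fun _ _ => by positivity
  have hDnn : ∀ t, 0 ≤ D t := fun t => Finset.sum_nonneg fun _ _ => by positivity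
  have hMderiv : ∀ t, 0 ≤ t → HasDerivWithinAt M (2 * S t) (Ici 0) t := by
    intro t ht
    have key : HasDerivWithinAt M (∑ n ∈ Finset.range (k + 1),
        (2 * f n t ^ 1 * v n t + 2 * f (n + 1) t ^ 1 * v (n + 1) t)) (Ici 0) t := by
      refine HasDerivWithinAt.fun_sum fun n hn => ?_
      have hn' := Finset.mem_range.1 hn
      exact ((hf n (by omega) t ht).fun_pow 2).add ((hf (n + 1) (by omega) t ht).fun_pow 2)
    convert key using 1
    simp only [hS, Finset.mul_sum]
    exact Finset.sum_congr rfl fun n _ => by ring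
  have hSeq : ∀ t, h / 2 * S t = -(1 / h) * D t
      + f (k + 1) t * (max (f (k + 1) t) 0 ^ p - f (k + 1) t) := by
    intro t
    have := sum_by_parts_flux hh.ne' k (fun n => f n t) (fun n => v n t) (fun n => f n t)
      (h0 t) (hi t) (hl t)
    simpa only [hS, hD, pow_two] using this
  have hEderiv : ∀ t, 0 ≤ t → HasDerivWithinAt E (-(h / 2 * N t)) (Ici 0) t := by
    intro t ht
    have hDd : HasDerivWithinAt D (∑ n ∈ Finset.range (k + 1),
        (2 * (f (n + 1) t - f n t) ^ 1 * (v (n + 1) t - v n t))) (Ici 0) t := by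
      refine HasDerivWithinAt.fun_sum fun n hn => ?_
      have hn' := Finset.mem_range.1 hn
      exact ((hf (n + 1) (by omega) t ht).sub (hf n (by omega) t ht)).fun_pow 2
    have hlast := hf (k + 1) le_rfl t ht
    have key := (hDd.const_mul (1 / (2 * h))).sub
      (((hasDerivAt_max_zero_rpow (by linarith : 0 < p) (f (k + 1) t)).comp_hasDerivWithinAt t
        hlast).sub ((hlast.fun_pow 2).div_const 2))
    refine key.congr_deriv ?_
    have parts := sum_by_parts_flux hh.ne' k (fun n => f n t) (fun n => v n t) (fun n => v n t)
      (h0 t) (hi t) (hl t)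
    have hNeq : N t = ∑ n ∈ Finset.range (k + 1), (v n t * v n t + v (n + 1) t * v (n + 1) t) := by
      simp only [hN, pow_two]
    have hsum : ∑ n ∈ Finset.range (k + 1),
        (2 * (f (n + 1) t - f n t) ^ 1 * (v (n + 1) t - v n t))
        = 2 * ∑ n ∈ Finset.range (k + 1), (v (n + 1) t - v n t) * (f (n + 1) t - f n t) := by
      rw [Finset.mul_sum]
      exact Finset.sum_congr rfl fun n _ => by ring
    rw [hNeq, parts, hsum]
    push_cast
    field_simp
    ring
  have hanti : ∀ t, 0 ≤ t → E t ≤ E 0 := by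
    intro t ht
    have : AntitoneOn E (Ici 0) := by
      refine antitoneOn_of_hasDerivWithinAt_nonpos (f' := fun t => -(h / 2 * N t))
        (convex_Ici 0) (fun x hx => (hEderiv x hx).continuousWithinAt) (fun x hx => ?_)
        (fun x _ => ?_)
      · rw [interior_Ici] at hx ⊢
        exact (hEderiv x hx.le).mono Ioi_subset_Ici_self
      · have := mul_nonneg hh.le (hNnn x)
        linarith
    exact this self_mem_Ici ht ht
  have hCS : ∀ t, S t ^ 2 ≤ M t * N t := by
    intro t
    refine Finset.sum_sq_le_sum_mul_sum_of_sq_le_mul _ (fun _ _ => by positivity)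
      (fun _ _ => by positivity) fun n _ => ?_
    nlinarith [sq_nonneg (f n t * v (n + 1) t - f (n + 1) t * v n t)]
  obtain ⟨κ, hκ, hκC⟩ : ∃ κ : ℝ, 0 < κ ∧
      ∀ t, κ * M t ≤ 2 / h * ((p - 1) / 2 * (1 / h * D t + f (k + 1) t ^ 2)) := by
    have hp1 : 0 < p - 1 := by linarith
    refine ⟨(p - 1) / h * min (1 / h) 1 / C, by positivity, fun t => ?_⟩
    have h1 : M t / C ≤ D t + f (k + 1) t ^ 2 := by
      rw [div_le_iff₀ hC, mul_comm]
      exact hpoin fun n => f n t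
    have hm : 0 < min (1 / h) 1 := by positivity
    have h2 : min (1 / h) 1 * (D t + f (k + 1) t ^ 2) ≤ 1 / h * D t + f (k + 1) t ^ 2 := by
      rw [mul_add]
      have := mul_le_mul_of_nonneg_right (min_le_left (1 / h) 1) (hDnn t)
      have := mul_le_mul_of_nonneg_right (min_le_right (1 / h) 1) (sq_nonneg (f (k + 1) t))
      linarith
    calc (p - 1) / h * min (1 / h) 1 / C * M t
        = (p - 1) / h * (min (1 / h) 1 * (M t / C)) := by ring
      _ ≤ (p - 1) / h * (1 / h * D t + f (k + 1) t ^ 2) := by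
          refine mul_le_mul_of_nonneg_left ?_ (by positivity)
          exact (mul_le_mul_of_nonneg_left h1 hm.le).trans h2
      _ = _ := by field_simp
  have hJ : ∀ t, 0 ≤ t → κ * M t - 2 / h * (p + 1) * E t ≤ 0 := by
    refine nonpos_of_concavity_ineq (M := M) (M' := fun t => 2 * S t)
      (J' := fun t => κ * (2 * S t) - 2 / h * (p + 1) * -(h / 2 * N t))
      (κ := κ) (q := (p + 1) / 2) hκ (by linarith) hMderiv
      (fun t ht => ((hMderiv t ht).const_mul κ).sub ((hEderiv t ht).const_mul _))
      (fun t _ => Finset.sum_nonneg fun _ _ => by positivity) ?_ ?_ ?_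
    · intro t _
      have hpow : f (k + 1) t * max (f (k + 1) t) 0 ^ p = max (f (k + 1) t) 0 ^ (p + 1) := by
        rcases le_total (f (k + 1) t) 0 with hs | hs
        · rw [max_eq_right hs, Real.zero_rpow (by linarith), Real.zero_rpow (by linarith), mul_zero]
        · rw [max_eq_left hs, Real.rpow_add_one' hs (by linarith), mul_comm]
      have hSE : S t = 2 / h * ((p - 1) / 2 * (1 / h * D t + f (k + 1) t ^ 2))
          - 2 / h * (p + 1) * E t := by
        have h1 : S t = 2 / h * (h / 2 * S t) := by field_simp
        rw [h1, hSeq, mul_sub, hpow, hE]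
        have : p + 1 ≠ 0 := by linarith
        field_simp
        ring
      have := hκC t
      linarith
    · intro t _
      have h1 : 2 / h * (p + 1) * -(h / 2 * N t) = -((p + 1) * N t) := by field_simp
      have := mul_nonneg (by linarith : 0 ≤ p + 1) (hNnn t)
      linarith
    · intro t _ hSt
      have h1 : 2 / h * (p + 1) * -(h / 2 * N t) = -((p + 1) * N t) := by field_simp
      have h2 := mul_le_mul_of_nonneg_left (hCS t) (by linarith : 0 ≤ p + 1)
      have h3 : 0 ≤ κ * (2 * S t) * M t :=
        mul_nonneg (mul_nonneg hκ.le hSt) (Finset.sum_nonneg fun _ _ => by positivity)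
      simp only [h1]
      linarith
  refine ⟨2 / h * (p + 1) * E 0 / κ, fun t ht => ?_⟩
  rw [le_div_iff₀ hκ, mul_comm]
  have h1 := hJ t ht
  have h2 := mul_le_mul_of_nonneg_left (hanti t ht)
    (mul_nonneg (by positivity : 0 ≤ 2 / h) (by linarith : 0 ≤ p + 1))
  change κ * M t ≤ _
  linarith

/-- every globally defined solution of (1.1) is bounded. -/
theorem stmt3 (d : ℕ) (hd : 2 ≤ d) (h p : ℝ) (hh : 0 < h) (hp : 1 < p)
    (U : ℝ → Fin d → ℝ)
    (hU : ∀ t : ℝ, 0 ≤ t → HasDerivWithinAt U (bField d h p (U t)) (Set.Ici 0) t) :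
    ∃ C : ℝ, ∀ t : ℝ, 0 ≤ t → euclNorm (U t) ≤ C := by
  obtain ⟨k, rfl⟩ : ∃ k, d = k + 2 := ⟨d - 2, by omega⟩
  have hbound : ∃ B : ℝ, ∀ t, 0 ≤ t →
      ∑ n ∈ Finset.range (k + 1), (coordFn (U t) n ^ 2 + coordFn (U t) (n + 1) ^ 2) ≤ B := by
    refine exists_bound_of_semidiscrete hh hp k (fun n t => coordFn (U t) n)
      (fun n t => coordFn (bField (k + 2) h p (U t)) n) ?_ ?_ ?_ ?_
    · intro n hn t ht
      have hn' : n < k + 2 := by omega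
      simpa only [coordFn, hn', dif_pos] using hasDerivWithinAt_pi.1 (hU t ht) ⟨n, hn'⟩
    · intro t
      simp [coordFn, bField]
    · intro t n hn
      have h1 : n + 1 < k + 2 := by omega
      have h3 : n ≠ k := by omega
      conv_lhs => rw [coordFn, dif_pos h1]
      simp [bField, h3]
    · intro t
      conv_lhs => rw [coordFn, dif_pos (by omega : k + 1 < k + 2)]
      simp [bField]
  obtain ⟨B, hB⟩ := hbound
  refine ⟨Real.sqrt (∑ _i : Fin (k + 2), B), fun t ht => ?_⟩
  refine Real.sqrt_le_sqrt (Finset.sum_le_sum fun i _ => ?_)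
  refine le_trans ?_ (hB t ht)
  have hval : U t i = coordFn (U t) i := by simp [coordFn]
  have hnn : ∀ n ∈ Finset.range (k + 1),
      0 ≤ coordFn (U t) n ^ 2 + coordFn (U t) (n + 1) ^ 2 := fun _ _ => by positivity
  rw [hval]
  rcases Nat.lt_or_ge i (k + 1) with hik | hik
  · refine le_trans ?_ (Finset.single_le_sum hnn (Finset.mem_range.2 hik))
    linarith [sq_nonneg (coordFn (U t) (i + 1))]
  · have hi : (i : ℕ) = k + 1 := by omega
    refine le_trans ?_ (Finset.single_le_sum hnn (Finset.mem_range.2 (Nat.lt_succ_self k)))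
    rw [hi]
    linarith [sq_nonneg (coordFn (U t) k)]
end

section
/- The system (1.1) has exactly two equilibria: for u ∈ ℝ^d, b(u) = 0 if and only if u = 0 or u = 𝟙. -/
open scoped BigOperators
open Filter Topology Set

theorem coordFn_const {d : ℕ} (c : ℝ) {n : ℕ} (hn : n < d) :
    coordFn (fun _ : Fin d => c) n = c := by
  simp [coordFn, hn]

/-- At an equilibrium, all coordinates are equal. -/
theorem coordFn_eq_of_bField_eq_zero {d : ℕ} {h p : ℝ} (hh : h ≠ 0) {u : Fin d → ℝ}
    (hb : bField d h p u = 0) : ∀ n < d, coordFn u n = coordFn u 0 := by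
  intro n
  induction n using Nat.strong_induction_on with
  | _ n ih =>
    intro hn
    match n with
    | 0 => rfl
    | 1 =>
      have h0 := congrFun hb ⟨0, by omega⟩
      simp [bField, hh] at h0
      linarith
    | k + 2 =>
      have h1 := congrFun hb ⟨k + 1, by omega⟩
      have hk : k + 1 ≠ d - 1 := by omega
      simp [bField, hh, hk] at h1
      have e0 := ih k (by omega) (by omega)
      have e1 := ih (k + 1) (by omega) (by omega)
      linarith

/-- A constant vector is an equilibrium exactly when its value is a zero of the reaction term. -/
theorem bField_const_eq_zero_iff {d : ℕ} (hd : 2 ≤ d) {h p : ℝ} (hh : h ≠ 0) (c : ℝ) :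
    bField d h p (fun _ => c) = 0 ↔ (max c 0) ^ p = c := by
  constructor
  · intro hb
    have hl := congrFun hb ⟨d - 1, by omega⟩
    have h0 : d - 1 ≠ 0 := by omega
    simp only [bField, h0, if_false, if_true, coordFn_const c (show d - 1 < d by omega),
      coordFn_const c (show d - 2 < d by omega), Pi.zero_apply, neg_add_cancel, zero_add] at hl
    have hc : (2 / h ^ 2) * h ≠ 0 := by positivity
    rw [← mul_assoc] at hl
    exact sub_eq_zero.1 ((mul_eq_zero.1 hl).resolve_left hc)
  · intro hc
    ext ⟨i, hi⟩
    simp only [bField, Pi.zero_apply]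
    split_ifs with h0 h1
    · rw [coordFn_const c (by omega), coordFn_const c (by omega)]
      ring
    · rw [coordFn_const c (by omega), coordFn_const c (by omega), hc]
      ring
    · rw [coordFn_const c (by omega), coordFn_const c (by omega), coordFn_const c (by omega)]
      ring

theorem max_zero_rpow_eq_self_iff {p : ℝ} (hp : 1 < p) (c : ℝ) :
    (max c 0) ^ p = c ↔ c = 0 ∨ c = 1 := by
  constructor
  · intro hc
    rcases le_or_gt c 0 with h | h
    · rw [max_eq_right h, Real.zero_rpow (by linarith)] at hc
      exact Or.inl hc.symm
    · rw [max_eq_left h.le] at hc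
      rcases lt_trichotomy c 1 with h1 | h1 | h1
      · have := Real.rpow_lt_self_of_lt_one h h1 hp
        linarith
      · exact Or.inr h1
      · have := Real.self_lt_rpow_of_one_lt h1 hp
        linarith
  · rintro (rfl | rfl)
    · simp [Real.zero_rpow (show p ≠ 0 by linarith)]
    · simp

/-- the system (1.1) has exactly two equilibria, `0` and `𝟙 = (1,…,1)`. -/
theorem stmt5 (d : ℕ) (hd : 2 ≤ d) (h p : ℝ) (hh : 0 < h) (hp : 1 < p) (u : Fin d → ℝ) :
    bField d h p u = 0 ↔ u = 0 ∨ u = fun _ => 1 := by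
  have hh0 : h ≠ 0 := hh.ne'
  constructor
  · intro hb
    have hu : u = fun _ => coordFn u 0 := by
      ext ⟨i, hi⟩
      rw [← coordFn_eq_of_bField_eq_zero hh0 hb i hi]
      simp [coordFn, hi]
    rw [hu, bField_const_eq_zero_iff hd hh0, max_zero_rpow_eq_self_iff hp] at hb
    rcases hb with hc | hc
    · exact Or.inl (by rw [hu, hc]; rfl)
    · exact Or.inr (by rw [hu, hc])
  · rintro (rfl | rfl)
    · exact (bField_const_eq_zero_iff hd hh0 0).2 ((max_zero_rpow_eq_self_iff hp 0).2 (Or.inl rfl))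
    · exact (bField_const_eq_zero_iff hd hh0 1).2 ((max_zero_rpow_eq_self_iff hp 1).2 (Or.inr rfl))
end

section
/- (Hyperbolicity of the stable equilibrium) Let J₀ be the d×d real matrix defined by (J₀u)_1 = (2/h²)(−u_1 + u_2), (J₀u)_i = (1/h²)(u_{i+1} − 2u_i + u_{i−1}) for 2 ≤ i ≤ d−1, and (J₀u)_d = (2/h²)(−u_d + u_{d−1}) − (2/h)u_d (this is the Jacobian matrix of b at the origin, since g'(0) = −1 for p > 1). Then J₀ is diagonalizable over ℝ and every eigenvalue of J₀ is a negative real number. -/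
open scoped BigOperators
open Filter Topology Set

/-- An endomorphism that is conjugate to a symmetric operator on a finite-dimensional real inner
product space is diagonalizable. -/
theorem iSup_eigenspace_eq_top_of_isSymmetric_conj {V E : Type*} [AddCommGroup V] [Module ℝ V]
    [NormedAddCommGroup E] [InnerProductSpace ℝ E] [FiniteDimensional ℝ E]
    (f : Module.End ℝ V) (e : V ≃ₗ[ℝ] E) (hf : (e.conj f).IsSymmetric) :
    (⨆ μ : ℝ, Module.End.eigenspace f μ) = ⊤ := by
  have htop : (⨆ μ : ℝ, Module.End.eigenspace (e.conj f) μ) = ⊤ :=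
    Submodule.orthogonal_eq_bot_iff.mp hf.orthogonalComplement_iSup_eigenspaces_eq_bot
  have hmap (μ : ℝ) : (Module.End.eigenspace (e.conj f) μ).map (e.symm : E →ₗ[ℝ] V) ≤
      Module.End.eigenspace f μ := by
    rintro _ ⟨x, hx, rfl⟩
    rw [SetLike.mem_coe, Module.End.mem_eigenspace_iff, LinearEquiv.conj_apply_apply] at hx
    rw [Module.End.mem_eigenspace_iff]
    apply e.injective
    simpa using hx
  rw [eq_top_iff]
  calc (⊤ : Submodule ℝ V) = (⊤ : Submodule ℝ E).map (e.symm : E →ₗ[ℝ] V) := by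
        rw [Submodule.map_top, LinearEquiv.range]
    _ = ⨆ μ : ℝ, (Module.End.eigenspace (e.conj f) μ).map (e.symm : E →ₗ[ℝ] V) := by
        rw [← htop, Submodule.map_iSup]
    _ ≤ _ := iSup_mono hmap

/-- An endomorphism of `ι → ℝ` that is symmetric for a positively weighted dot product is
diagonalizable. -/
theorem iSup_eigenspace_eq_top_of_weighted_symmetric {ι : Type*} [Fintype ι]
    (f : Module.End ℝ (ι → ℝ)) (w : ι → ℝ) (hw : ∀ i, 0 < w i)
    (hf : ∀ u v : ι → ℝ, ∑ i, w i * f u i * v i = ∑ i, w i * f v i * u i) :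
    (⨆ μ : ℝ, Module.End.eigenspace f μ) = ⊤ := by
  have hs (i : ι) : √(w i) ≠ 0 := (Real.sqrt_pos.mpr (hw i)).ne'
  let e : (ι → ℝ) ≃ₗ[ℝ] EuclideanSpace ℝ ι :=
    (LinearEquiv.piCongrRight fun i => LinearEquiv.smulOfNeZero ℝ ℝ (√(w i)) (hs i)).trans
      (WithLp.linearEquiv 2 ℝ (ι → ℝ)).symm
  have he (u : ι → ℝ) (i : ι) : e u i = √(w i) * u i := rfl
  refine iSup_eigenspace_eq_top_of_isSymmetric_conj f e fun x y => ?_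
  obtain ⟨u, rfl⟩ := e.surjective x
  obtain ⟨v, rfl⟩ := e.surjective y
  simp only [LinearEquiv.conj_apply_apply, LinearEquiv.symm_apply_apply, PiLp.inner_apply,
    RCLike.inner_apply, conj_trivial, he]
  convert hf u v using 2 with i _ i _
  · linear_combination (v i * f u i) * Real.mul_self_sqrt (hw i).le
  · linear_combination (u i * f v i) * Real.mul_self_sqrt (hw i).le

/-- Summation by parts for the discrete Laplacian. -/
theorem sum_laplacian_mul (U V : ℕ → ℝ) (m : ℕ) :
    (U 1 - U 0) * V 0 + ∑ n ∈ Finset.range m, (U (n + 2) - 2 * U (n + 1) + U n) * V (n + 1) =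
      (U (m + 1) - U m) * V (m + 1) -
        ∑ n ∈ Finset.range (m + 1), (U (n + 1) - U n) * (V (n + 1) - V n) := by
  induction m with
  | zero => simp; ring
  | succ m ih =>
    rw [Finset.sum_range_succ, Finset.sum_range_succ _ (m + 1)]
    linear_combination ih

/-- The trapezoidal weights: `1/2` at the two end points and `1` elsewhere. -/
noncomputable def trapezoidWeight (d : ℕ) (i : Fin d) : ℝ :=
  if (i : ℕ) = 0 ∨ (i : ℕ) = d - 1 then 1 / 2 else 1

theorem trapezoidWeight_pos (d : ℕ) (i : Fin d) : 0 < trapezoidWeight d i := by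
  unfold trapezoidWeight
  split_ifs <;> norm_num

theorem coordFn_val {d : ℕ} (u : Fin d → ℝ) (i : Fin d) : coordFn u i = u i := by
  simp [coordFn]

/-- The Dirichlet form of the discrete Laplacian with reflecting boundary at the left end and
absorbing (Robin) boundary at the right end. -/
theorem sum_trapezoidWeight_mul (m : ℕ) (h : ℝ) (u v f : Fin (m + 2) → ℝ)
    (hf : ∀ i : Fin (m + 2), f i =
      if (i : ℕ) = 0 then (2 / h ^ 2) * (-coordFn u 0 + coordFn u 1)
      else if (i : ℕ) = m + 2 - 1 then
        (2 / h ^ 2) * (-coordFn u (m + 2 - 1) + coordFn u (m + 2 - 2))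
          - (2 / h) * coordFn u (m + 2 - 1)
      else (1 / h ^ 2) * (coordFn u ((i : ℕ) + 1) - 2 * coordFn u (i : ℕ)
        + coordFn u ((i : ℕ) - 1))) :
    ∑ i, trapezoidWeight (m + 2) i * f i * v i =
      -(1 / h ^ 2 * ∑ n ∈ Finset.range (m + 1),
        (coordFn u (n + 1) - coordFn u n) * (coordFn v (n + 1) - coordFn v n)) -
      1 / h * (coordFn u (m + 1) * coordFn v (m + 1)) := by
  have hmid (n : Fin m) : trapezoidWeight (m + 2) n.castSucc.succ * f n.castSucc.succ *
      v n.castSucc.succ = 1 / h ^ 2 * ((coordFn u (n + 2) - 2 * coordFn u (n + 1) + coordFn u n) *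
        coordFn v (n + 1)) := by
    have hn : (n : ℕ) ≠ m := n.isLt.ne
    rw [hf, ← coordFn_val v]
    simp [trapezoidWeight, hn]
    ring
  rw [Fin.sum_univ_succ, Fin.sum_univ_castSucc, Finset.sum_congr rfl fun n _ => hmid n,
    Fin.sum_univ_eq_sum_range (fun n => 1 / h ^ 2 *
      ((coordFn u (n + 2) - 2 * coordFn u (n + 1) + coordFn u n) * coordFn v (n + 1))) m,
    ← Finset.mul_sum, hf, hf, ← coordFn_val v, ← coordFn_val v]
  simp [trapezoidWeight]
  linear_combination 1 / h ^ 2 * sum_laplacian_mul (coordFn u) (coordFn v) m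

/-- Hyperbolicity of the stable equilibrium: the Jacobian matrix `J₀` of `b` at
the origin is diagonalizable over `ℝ` (the eigenspaces span everything) and all its eigenvalues
are negative. -/
theorem stmt7 (d : ℕ) (hd : 2 ≤ d) (h p : ℝ) (hh : 0 < h) (hp : 1 < p)
    (J : Matrix (Fin d) (Fin d) ℝ)
    (hJ : ∀ (u : Fin d → ℝ) (i : Fin d),
      J.mulVec u i =
        if (i : ℕ) = 0 then (2 / h ^ 2) * (-coordFn u 0 + coordFn u 1)
        else if (i : ℕ) = d - 1 then
          (2 / h ^ 2) * (-coordFn u (d - 1) + coordFn u (d - 2)) - (2 / h) * coordFn u (d - 1)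
        else (1 / h ^ 2) * (coordFn u ((i : ℕ) + 1) - 2 * coordFn u (i : ℕ)
          + coordFn u ((i : ℕ) - 1))) :
    (⨆ μ : ℝ, Module.End.eigenspace (Matrix.toLin' J) μ) = ⊤ ∧
    ∀ μ : ℝ, Module.End.HasEigenvalue (Matrix.toLin' J) μ → μ < 0 := by
  obtain ⟨m, rfl⟩ : ∃ m, d = m + 2 := ⟨d - 2, by omega⟩
  have hform (u v : Fin (m + 2) → ℝ) :=
    sum_trapezoidWeight_mul m h u v (Matrix.toLin' J u) (hJ u)
  refine ⟨iSup_eigenspace_eq_top_of_weighted_symmetric _ _ (trapezoidWeight_pos (m + 2))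
    fun u v => ?_, fun μ hμ => ?_⟩
  · rw [hform, hform, mul_comm (coordFn u _)]
    simp only [mul_comm (coordFn u _ - coordFn u _)]
  obtain ⟨u, hu, hu0⟩ := hμ.exists_hasEigenvector
  rw [Module.End.mem_eigenspace_iff] at hu
  by_contra! hμ0
  apply hu0
  have hmain := hform u u
  have hleft : 0 ≤ ∑ i, trapezoidWeight (m + 2) i * Matrix.toLin' J u i * u i := by
    refine Finset.sum_nonneg fun i _ => ?_
    rw [hu, Pi.smul_apply, smul_eq_mul]
    have := mul_nonneg (mul_nonneg (trapezoidWeight_pos (m + 2) i).le hμ0) (mul_self_nonneg (u i))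
    linarith
  set S := ∑ n ∈ Finset.range (m + 1),
    (coordFn u (n + 1) - coordFn u n) * (coordFn u (n + 1) - coordFn u n)
  have hS0 : 0 ≤ S := Finset.sum_nonneg fun n _ => mul_self_nonneg _
  have h1 : 0 ≤ 1 / h ^ 2 * S := by positivity
  have h2 : 0 ≤ 1 / h * (coordFn u (m + 1) * coordFn u (m + 1)) :=
    mul_nonneg (by positivity) (mul_self_nonneg _)
  have hSz : S = 0 := by
    have : 1 / h ^ 2 * S = 0 := by linarith
    simpa [hh.ne'] using this
  have hlast : coordFn u (m + 1) = 0 := by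
    have : 1 / h * (coordFn u (m + 1) * coordFn u (m + 1)) = 0 := by linarith
    simpa [hh.ne'] using this
  have hstep (n : ℕ) (hn : n < m + 1) : coordFn u (n + 1) = coordFn u n := by
    have := (Finset.sum_eq_zero_iff_of_nonneg fun n _ => mul_self_nonneg _).mp hSz n
      (Finset.mem_range.mpr hn)
    exact sub_eq_zero.mp (mul_self_eq_zero.mp this)
  have hzero (n : ℕ) (hn : n ≤ m + 1) : coordFn u n = 0 := by
    induction hn using Nat.decreasingInduction with
    | self => exact hlast
    | of_succ k hk ih => rw [← hstep k hk, ih]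
  ext i
  rw [← coordFn_val u, hzero i (by omega), Pi.zero_apply]
end
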